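/- Let n ≥ 1 and let 𝓕 ⊆ 2^[n] be a nonempty set system. Then 𝓕 is s-extremal and of VC-dimension at most 1 if and only if its inclusion graph G_𝓕 is a tree (i.e. connected and acyclic) and all edge labels of G_𝓕 are pairwise distinct. -/

import Mathlib

open Finset

/-- The family of subsets of `[n]` (identified with `Fin n`) shattered by the
set system `F ⊆ 2^[n]`. -/
def Sh (n : ℕ) (F : Finset (Finset (Fin n))) : Finset (Finset (Fin n)) :=
  Finset.univ.filter (fun S => ∀ H ∈ S.powerset, ∃ A ∈ F, A ∩ S = H)

/-- A set system is shattering-extremal (s-extremal) if it shatters exactly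
`|F|` sets. -/
def SExtremal (n : ℕ) (F : Finset (Finset (Fin n))) : Prop :=
  (Sh n F).card = F.card

/-- The inclusion graph of a set system: vertices are the members of `F`,
two sets adjacent iff their symmetric difference is a single element. -/
def inclGraph (n : ℕ) (F : Finset (Finset (Fin n))) : SimpleGraph {A // A ∈ F} where
  Adj A B := (symmDiff A.1 B.1).card = 1
  symm := ⟨by intro A B h; rwa [symmDiff_comm]⟩
  loopless := ⟨by intro A h; simp [symmDiff_self] at h⟩

lemma mem_Sh {n : ℕ} {F : Finset (Finset (Fin n))} {S : Finset (Fin n)} :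
    S ∈ Sh n F ↔ F.Shatters S := by
  simp [Sh, Shatters, inter_comm]

lemma Sh_eq_shatterer (n : ℕ) (F : Finset (Finset (Fin n))) : Sh n F = F.shatterer := by
  ext S
  rw [mem_Sh, mem_shatterer]

lemma Finset.symmDiff_eq_singleton_iff {α : Type*} [DecidableEq α] {A B : Finset α} {x : α} :
    symmDiff A B = {x} ↔ ∀ z, (z ∈ A ↔ z ∈ B) ↔ z ≠ x := by
  simp only [Finset.ext_iff, mem_symmDiff, mem_singleton]
  refine forall_congr' fun z ↦ ?_
  tauto

lemma Finset.shatters_singleton_iff {α : Type*} [DecidableEq α] {F : Finset (Finset α)} {x : α} :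
    F.Shatters {x} ↔ (∃ A ∈ F, x ∈ A) ∧ ∃ B ∈ F, x ∉ B := by
  refine ⟨fun h ↦ ?_, fun ⟨⟨A, hA, hxA⟩, B, hB, hxB⟩ t ht ↦ ?_⟩
  · obtain ⟨A, hA, hA'⟩ := h (subset_refl {x})
    obtain ⟨B, hB, hB'⟩ := h (empty_subset {x})
    exact ⟨⟨A, hA, by simpa using hA'⟩, B, hB,
      fun hxB ↦ by simp [singleton_inter_of_mem hxB] at hB'⟩
  · rcases subset_singleton_iff.1 ht with rfl | rfl
    · exact ⟨B, hB, singleton_inter_of_notMem hxB⟩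
    · exact ⟨A, hA, by simpa using hxA⟩

lemma Finset.shatters_pair {α : Type*} [DecidableEq α] {F : Finset (Finset α)} {x z : α}
    (h : ∀ p q : Prop, ∃ A ∈ F, (x ∈ A ↔ p) ∧ (z ∈ A ↔ q)) : F.Shatters {x, z} := by
  intro t ht
  obtain ⟨A, hA, hx, hz⟩ := h (x ∈ t) (z ∈ t)
  refine ⟨A, hA, ?_⟩
  ext w
  have := @ht w
  simp only [mem_inter, mem_insert, mem_singleton] at this ⊢
  grind

/-- If `F` is shattering-extremal and shatters `{x}`, then two members of `F` differ exactly in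
`x`. -/
lemma Finset.exists_symmDiff_eq_singleton {α : Type*} [DecidableEq α] {F : Finset (Finset α)}
    (hF : #F.shatterer ≤ #F) {x : α} (hx : F.Shatters {x}) :
    ∃ A ∈ F, ∃ B ∈ F, symmDiff A B = {x} := by
  by_contra! h
  have hinj : Set.InjOn (fun A : Finset α ↦ A.erase x) F := by
    intro A hA B hB hAB
    have hz (z : α) (hz : z ≠ x) : z ∈ A ↔ z ∈ B := by
      simpa [hz] using Finset.ext_iff.1 hAB z
    by_cases hxAB : x ∈ A ↔ x ∈ B
    · ext z
      by_cases hzx : z = x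
      · rwa [hzx]
      · exact hz z hzx
    · refine absurd (symmDiff_eq_singleton_iff.2 fun z ↦ ⟨?_, hz z⟩) (h A hA B hB)
      rintro hzAB rfl
      exact hxAB hzAB
  have hsub : (F.image fun A ↦ A.erase x).shatterer ⊆ F.shatterer.erase {x} := by
    intro S hS
    rw [mem_shatterer] at hS
    have hxS : x ∉ S := by
      intro hxS
      obtain ⟨u, hu, hSu⟩ := hS.exists_superset
      obtain ⟨A, -, rfl⟩ := mem_image.1 hu
      simpa using hSu hxS
    refine mem_erase.2 ⟨by rintro rfl; simp at hxS, mem_shatterer.2 fun t ht ↦ ?_⟩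
    obtain ⟨u, hu, hSu⟩ := hS ht
    obtain ⟨A, hA, rfl⟩ := mem_image.1 hu
    refine ⟨A, hA, ?_⟩
    rw [← hSu, inter_erase, erase_eq_of_notMem]
    simp [hxS]
  have h1 := card_le_card hsub
  have h2 := card_le_card_shatterer (F.image fun A ↦ A.erase x)
  rw [card_image_of_injOn hinj] at h2
  have h3 := card_erase_lt_of_mem (mem_shatterer.2 hx)
  omega

/-- An acyclic graph on a nonempty vertex set with enough edges is connected. -/
lemma SimpleGraph.IsAcyclic.isTree_of_card_le {V : Type*} [Finite V] [Nonempty V]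
    {G : SimpleGraph V} (hG : G.IsAcyclic) (hcard : Nat.card V ≤ Nat.card G.edgeSet + 1) :
    G.IsTree := by
  obtain ⟨T, hGT, -, hT⟩ := connected_top.exists_isTree_le_of_le_of_isAcyclic le_top hG
  have hTcard := (isTree_iff_connected_and_card.1 hT).2
  have heq : G.edgeSet = T.edgeSet := by
    refine Set.eq_of_subset_of_ncard_le (edgeSet_mono hGT) ?_ (Set.toFinite _)
    rw [← Nat.card_coe_set_eq, ← Nat.card_coe_set_eq]
    omega
  rwa [edgeSet_inj.1 heq]

lemma SimpleGraph.Connected.exists_adj_ne {V β : Type*} {G : SimpleGraph V} (hG : G.Connected)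
    (f : V → β) {u v : V} (h : f u ≠ f v) : ∃ a b, G.Adj a b ∧ f a ≠ f b := by
  obtain ⟨p⟩ := hG.preconnected u v
  obtain ⟨d, -, h1, h2⟩ := p.exists_boundary_dart {w | f w = f u} rfl h.symm
  exact ⟨d.fst, d.snd, d.adj, fun h ↦ h2 (h.symm.trans h1)⟩

lemma inclGraph_adj_iff {n : ℕ} {F : Finset (Finset (Fin n))} {A B : {A // A ∈ F}} :
    (inclGraph n F).Adj A B ↔ ∃ x, symmDiff A.1 B.1 = {x} :=
  card_eq_one

/-- If every shattered singleton is the label of an edge, and every shattered set has at most one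
element, then there are at most `|E| + 1` shattered sets. -/
lemma card_Sh_le {n : ℕ} {F : Finset (Finset (Fin n))} (hS : ∀ S ∈ Sh n F, S.card ≤ 1)
    (h : ∀ x, {x} ∈ Sh n F → ∃ A B : {A // A ∈ F}, symmDiff A.1 B.1 = {x}) :
    (Sh n F).card ≤ Nat.card (inclGraph n F).edgeSet + 1 := by
  classical
  let label : Sym2 {A // A ∈ F} → Finset (Fin n) :=
    Sym2.lift ⟨fun A B ↦ symmDiff A.1 B.1, fun A B ↦ symmDiff_comm _ _⟩
  have hsub : Sh n F ⊆ insert ∅ ((inclGraph n F).edgeFinset.image label) := by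
    intro S hSF
    rcases Nat.le_one_iff_eq_zero_or_eq_one.1 (hS S hSF) with h0 | h1
    · simp [card_eq_zero.1 h0]
    · obtain ⟨x, rfl⟩ := card_eq_one.1 h1
      obtain ⟨A, B, hAB⟩ := h x hSF
      refine mem_insert_of_mem (mem_image.2 ⟨s(A, B), ?_, hAB⟩)
      rw [SimpleGraph.mem_edgeFinset, SimpleGraph.mem_edgeSet]
      exact inclGraph_adj_iff.2 ⟨x, hAB⟩
  calc (Sh n F).card ≤ _ := card_le_card hsub
    _ ≤ _ := card_insert_le _ _
    _ ≤ #(inclGraph n F).edgeFinset + 1 := by gcongr; exact card_image_le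
    _ = _ := by rw [Nat.card_eq_fintype_card, SimpleGraph.edgeFinset_card]

lemma exists_symmDiff_eq_of_connected {n : ℕ} {F : Finset (Finset (Fin n))}
    (hG : (inclGraph n F).Connected) {x : Fin n} (hx : {x} ∈ Sh n F) :
    ∃ A B : {A // A ∈ F}, symmDiff A.1 B.1 = {x} := by
  obtain ⟨⟨A, hA, hxA⟩, B, hB, hxB⟩ := shatters_singleton_iff.1 (mem_Sh.1 hx)
  obtain ⟨U, V, hUV, hne⟩ := hG.exists_adj_ne (fun C ↦ x ∈ C.1) (u := ⟨A, hA⟩) (v := ⟨B, hB⟩)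
    (by simp [hxA, hxB])
  obtain ⟨z, hz⟩ := inclGraph_adj_iff.1 hUV
  have := (symmDiff_eq_singleton_iff.1 hz x).not.1 (by simpa using hne)
  exact ⟨U, V, by rw [hz, not_not.1 this]⟩

/-- In a connected inclusion graph whose only `y`-labelled edge is `{U, V}`, if the members of `F`
having a fixed status at `y` do not all agree at `x`, then some `x`-labelled edge joins two members
with that status. -/
lemma exists_symmDiff_eq_of_status {n : ℕ} {F : Finset (Finset (Fin n))}
    (hG : (inclGraph n F).Connected) {x y : Fin n} (hxy : x ≠ y) {U V : {A // A ∈ F}}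
    (hUV : symmDiff U.1 V.1 = {y})
    (huniq : ∀ A B : {A // A ∈ F}, symmDiff A.1 B.1 = {y} → (A = U ∧ B = V) ∨ (A = V ∧ B = U))
    (q : Prop) {P Q : {A // A ∈ F}} (hP : y ∈ P.1 ↔ q) (hQ : y ∈ Q.1 ↔ q)
    (hxP : x ∈ P.1) (hxQ : x ∉ Q.1) :
    ∃ A B : {A // A ∈ F}, symmDiff A.1 B.1 = {x} ∧ (y ∈ A.1 ↔ q) ∧ (y ∈ B.1 ↔ q) := by
  classical
  let f : {A // A ∈ F} → Prop := fun A ↦ if y ∈ A.1 ↔ q then x ∈ A.1 else x ∈ U.1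
  obtain ⟨A, B, hAB, hne⟩ := hG.exists_adj_ne f (u := P) (v := Q) (by
    simp only [f, if_pos hP, if_pos hQ]
    simp [hxP, hxQ])
  obtain ⟨z, hz⟩ := inclGraph_adj_iff.1 hAB
  have hz' := symmDiff_eq_singleton_iff.1 hz
  by_cases hzy : z = y
  · subst hzy
    have hxUV := (symmDiff_eq_singleton_iff.1 hUV x).2 hxy
    have hAx : x ∈ A.1 ↔ x ∈ U.1 := by
      rcases huniq A B hz with ⟨rfl, -⟩ | ⟨rfl, -⟩
      exacts [Iff.rfl, hxUV.symm]
    have hBx := ((hz' x).2 hxy).symm.trans hAx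
    exact absurd (by simp only [f, hAx, hBx, ite_self]) hne
  · have hyAB := (hz' y).2 (Ne.symm hzy)
    by_cases hA : y ∈ A.1 ↔ q
    · have hB := hyAB.symm.trans hA
      simp only [f, if_pos hA, if_pos hB] at hne
      have hzx : x = z := not_not.1 ((hz' x).not.1 fun h ↦ hne (propext h))
      exact ⟨A, B, by rw [hz, hzx], hA, hB⟩
    · have hB : ¬ (y ∈ B.1 ↔ q) := fun h ↦ hA (hyAB.trans h)
      simp only [f, if_neg hA, if_neg hB] at hne
      exact absurd rfl hne

/-- The edge labels of the inclusion graph are pairwise distinct. -/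
def LabelsDistinct (n : ℕ) (F : Finset (Finset (Fin n))) : Prop :=
  ∀ A B C D : {A // A ∈ F}, (inclGraph n F).Adj A B → (inclGraph n F).Adj C D →
    symmDiff A.1 B.1 = symmDiff C.1 D.1 → (A = C ∧ B = D) ∨ (A = D ∧ B = C)

lemma labelsDistinct_of_card_le_one {n : ℕ} {F : Finset (Finset (Fin n))} (hvc : ∀ S ∈ Sh n F, S.card ≤ 1) :
    LabelsDistinct n F := by
  intro A B C D hAB _ heq
  obtain ⟨x, hx⟩ := inclGraph_adj_iff.1 hAB
  have hAB' := symmDiff_eq_singleton_iff.1 hx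
  have hCD' := symmDiff_eq_singleton_iff.1 (heq ▸ hx)
  have hagree (z : Fin n) (hz : z ≠ x) : z ∈ A.1 ↔ z ∈ C.1 := by
    by_contra hne
    have hAz := (hAB' z).2 hz
    have hCz := (hCD' z).2 hz
    have hAx := (hAB' x).not.2 (by simp)
    have hCx := (hCD' x).not.2 (by simp)
    have hsh : F.Shatters {x, z} := by
      refine shatters_pair fun p q ↦ ?_
      have : ((x ∈ A.1 ↔ p) ∧ (z ∈ A.1 ↔ q)) ∨ ((x ∈ B.1 ↔ p) ∧ (z ∈ B.1 ↔ q)) ∨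
          ((x ∈ C.1 ↔ p) ∧ (z ∈ C.1 ↔ q)) ∨ ((x ∈ D.1 ↔ p) ∧ (z ∈ D.1 ↔ q)) := by
        grind
      rcases this with h | h | h | h
      exacts [⟨A, A.2, h⟩, ⟨B, B.2, h⟩, ⟨C, C.2, h⟩, ⟨D, D.2, h⟩]
    have := hvc _ (mem_Sh.2 hsh)
    rw [card_pair hz.symm] at this
    omega
  have hAx := (hAB' x).not.2 (by simp)
  have hCx := (hCD' x).not.2 (by simp)
  by_cases hxAC : x ∈ A.1 ↔ x ∈ C.1
  · refine .inl ⟨?_, ?_⟩ <;> ext z <;> grind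
  · refine .inr ⟨?_, ?_⟩ <;> ext z <;> grind

lemma LabelsDistinct.isAcyclic {n : ℕ} {F : Finset (Finset (Fin n))}
    (h : LabelsDistinct n F) : (inclGraph n F).IsAcyclic := by
  rw [SimpleGraph.isAcyclic_iff_forall_adj_isBridge]
  intro A B hAB
  rw [SimpleGraph.isBridge_iff]
  rintro ⟨p⟩
  obtain ⟨x, hx⟩ := inclGraph_adj_iff.1 hAB
  have hAx := (symmDiff_eq_singleton_iff.1 hx x).not.2 (by simp)
  obtain ⟨d, -, h1, h2⟩ := p.exists_boundary_dart {C | x ∈ C.1 ↔ x ∈ A.1} Iff.rfl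
    (fun h ↦ hAx h.symm)
  obtain ⟨hd, hd'⟩ := SimpleGraph.deleteEdges_adj.1 d.adj
  obtain ⟨z, hz⟩ := inclGraph_adj_iff.1 hd
  simp only [Set.mem_ofPred_eq] at h1 h2
  obtain rfl : x = z := by
    by_contra hxz
    have := (symmDiff_eq_singleton_iff.1 hz x).2 hxz
    tauto
  apply hd'
  rcases h _ _ _ _ hd hAB (hz.trans hx.symm) with ⟨h1, h2⟩ | ⟨h1, h2⟩ <;>
    simp [h1, h2]

lemma LabelsDistinct.card_le_one {n : ℕ} {F : Finset (Finset (Fin n))}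
    (h : LabelsDistinct n F) (hG : (inclGraph n F).Connected) : ∀ S ∈ Sh n F, S.card ≤ 1 := by
  intro S hS
  by_contra! hcard
  obtain ⟨x, hxS, y, hyS, hxy⟩ := one_lt_card.1 hcard
  have hsh : F.Shatters {x, y} :=
    (mem_Sh.1 hS).mono_right (by simp [insert_subset_iff, hxS, hyS])
  have key (p q : Prop) : ∃ A : {A // A ∈ F}, (x ∈ A.1 ↔ p) ∧ (y ∈ A.1 ↔ q) := by
    classical
    obtain ⟨A, hA, hA'⟩ := hsh (filter_subset (fun w ↦ (w = x ∧ p) ∨ (w = y ∧ q)) {x, y})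
    have hx := Finset.ext_iff.1 hA' x
    have hy := Finset.ext_iff.1 hA' y
    simp [hxy, hxy.symm] at hx hy
    exact ⟨⟨A, hA⟩, hx, hy⟩
  obtain ⟨U, V, hUV⟩ := exists_symmDiff_eq_of_connected hG
    (mem_Sh.2 ((mem_Sh.1 hS).mono_right (singleton_subset_iff.2 hyS)))
  have huniq (A B : {A // A ∈ F}) (hAB : symmDiff A.1 B.1 = {y}) :=
    h A B U V (inclGraph_adj_iff.2 ⟨y, hAB⟩) (inclGraph_adj_iff.2 ⟨y, hUV⟩) (hAB.trans hUV.symm)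
  have edge (q : Prop) :
      ∃ A B : {A // A ∈ F}, symmDiff A.1 B.1 = {x} ∧ (y ∈ A.1 ↔ q) ∧ (y ∈ B.1 ↔ q) := by
    obtain ⟨P, hxP, hyP⟩ := key True q
    obtain ⟨Q, hxQ, hyQ⟩ := key False q
    exact exists_symmDiff_eq_of_status hG hxy hUV huniq q hyP hyQ (by simpa using hxP)
      (by simpa using hxQ)
  obtain ⟨A, B, hAB, hA, hB⟩ := edge True
  obtain ⟨C, D, hCD, hC, hD⟩ := edge False
  rcases h A B C D (inclGraph_adj_iff.2 ⟨x, hAB⟩) (inclGraph_adj_iff.2 ⟨x, hCD⟩)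
    (hAB.trans hCD.symm) with ⟨rfl, rfl⟩ | ⟨rfl, rfl⟩ <;> tauto

/-- A nonempty set system `F ⊆ 2^[n]` is s-extremal and of
VC-dimension at most 1 iff its inclusion graph is a tree (connected and
acyclic) and all edge labels (the symmetric differences along edges) are
pairwise distinct. -/
theorem stmt0 (n : ℕ) (hn : 1 ≤ n) (F : Finset (Finset (Fin n))) (hF : F.Nonempty) :
    (SExtremal n F ∧ ∀ S ∈ Sh n F, S.card ≤ 1) ↔
      ((inclGraph n F).Connected ∧ (inclGraph n F).IsAcyclic ∧
        ∀ A B C D : {A // A ∈ F}, (inclGraph n F).Adj A B → (inclGraph n F).Adj C D →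
          symmDiff A.1 B.1 = symmDiff C.1 D.1 → (A = C ∧ B = D) ∨ (A = D ∧ B = C)) := by
  have hV : Nat.card {A // A ∈ F} = #F := by simp
  have : Nonempty {A // A ∈ F} := hF.to_subtype
  constructor
  · rintro ⟨hext, hvc⟩
    have hlabel := labelsDistinct_of_card_le_one hvc
    have hacyc := hlabel.isAcyclic
    have hcard : (Sh n F).card = #F := hext
    refine ⟨(hacyc.isTree_of_card_le ?_).connected, hacyc, hlabel⟩
    rw [hV, ← hcard]
    refine card_Sh_le hvc fun x hx ↦ ?_
    obtain ⟨A, hA, B, hB, hAB⟩ := exists_symmDiff_eq_singleton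
      (by rw [← Sh_eq_shatterer, hcard]) (mem_Sh.1 hx)
    exact ⟨⟨A, hA⟩, ⟨B, hB⟩, hAB⟩
  · rintro ⟨hconn, hacyc, hlabel⟩
    have hvc := LabelsDistinct.card_le_one hlabel hconn
    refine ⟨le_antisymm ?_ (Sh_eq_shatterer n F ▸ card_le_card_shatterer F), hvc⟩
    have htree := (SimpleGraph.isTree_iff_connected_and_card.1 ⟨hconn, hacyc⟩).2
    rw [← hV, ← htree]
    exact card_Sh_le hvc fun x ↦ exists_symmDiff_eq_of_connected hconn
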